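/- Fix 0 < q < 1, a ∈ ℝ with t = q^a − q^{-a}, and n ∈ ℕ. In the (n+1)-dimensional representation of U_q(su(2)), the vector ξ⁺ = Σ_{p=0}^{n} (−i q^{−(a+n)})^p √((q^{2n}; q^{-2})_p / ((−1)^p (q^{-2}; q^{-2})_p)) ξ_p is an eigenvector of the operator i·π_{n/2}(B_t) with eigenvalue [a+n] = (q^{a+n} − q^{−a−n})/(q − q⁻¹), where B_t = q^{-1/2}(e − fk) − i(q−q⁻¹)⁻¹ t k. -/

import Mathlib

/-- q-Pochhammer symbol (x; r)_p = ∏_{j=0}^{p-1} (1 - r^j x). -/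
def qPoch (x r : ℝ) (p : ℕ) : ℝ := ∏ j ∈ Finset.range p, (1 - r ^ j * x)

/-- scalar weight under the square root -/
noncomputable def wt (q : ℝ) (n p : ℕ) : ℝ :=
  qPoch (q ^ (2 * n)) ((q ^ 2)⁻¹) p / ((-1 : ℝ) ^ p * qPoch ((q ^ 2)⁻¹) ((q ^ 2)⁻¹) p)

lemma wt_succ (q : ℝ) (hq0 : 0 < q) (n p : ℕ) :
    wt q n (p + 1) = wt q n p *
      ((1 - q ^ (2 * (n : ℝ) - 2 * p)) / (q ^ (-2 * (p : ℝ) - 2) - 1)) := by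
  have h1 : ((q ^ 2)⁻¹) ^ p * q ^ (2 * n) = q ^ (2 * (n : ℝ) - 2 * p) := by
    have e1 : 2 * (n : ℝ) = ((2 * n : ℕ) : ℝ) := by push_cast; ring
    have e2 : 2 * (p : ℝ) = ((2 * p : ℕ) : ℝ) := by push_cast; ring
    rw [Real.rpow_sub hq0, e1, e2, Real.rpow_natCast, Real.rpow_natCast, inv_pow, ← pow_mul]
    field_simp
  have h2 : ((q ^ 2)⁻¹) ^ p * (q ^ 2)⁻¹ = q ^ (-2 * (p : ℝ) - 2) := by
    have : -2 * (p : ℝ) - 2 = -(((2 * (p + 1) : ℕ)) : ℝ) := by push_cast; ring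
    rw [this, Real.rpow_neg hq0.le, Real.rpow_natCast, ← pow_succ, inv_pow, ← pow_mul]
  unfold wt qPoch
  rw [Finset.prod_range_succ, Finset.prod_range_succ, h1, h2, div_mul_div_comm]
  congr 1
  rw [pow_succ]; ring

lemma A_pos (q : ℝ) (hq0 : 0 < q) (hq1 : q < 1) (n p : ℕ) (h : p < n) :
    0 < 1 - q ^ (2 * (n : ℝ) - 2 * p) := by
  have : (p : ℝ) < n := by exact_mod_cast h
  have := Real.rpow_lt_one hq0.le hq1 (z := 2 * (n : ℝ) - 2 * p) (by linarith)
  linarith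

lemma B_pos (q : ℝ) (hq0 : 0 < q) (hq1 : q < 1) (p : ℕ) :
    0 < q ^ (-2 * (p : ℝ) - 2) - 1 := by
  have : (0 : ℝ) ≤ p := p.cast_nonneg
  have := Real.one_lt_rpow_of_pos_of_lt_one_of_neg hq0 hq1 (z := -2 * (p : ℝ) - 2) (by linarith)
  linarith

lemma sq_ratio (A B w : ℝ) (hA : 0 < A) (hB : 0 < B) :
    √(A * B) * √(w * (A / B)) = A * √w ∧ √(A * B) * √w = B * √(w * (A / B)) := by
  have h1 : 0 ≤ A / B := by positivity
  have hs : 0 < √B := Real.sqrt_pos.2 hB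
  have e1 := Real.mul_self_sqrt hA.le
  have e2 := Real.mul_self_sqrt hB.le
  rw [Real.sqrt_mul' _ h1, Real.sqrt_mul hA.le, Real.sqrt_div hA.le]
  constructor
  · field_simp; linear_combination √w * e1
  · field_simp; linear_combination √w * e2

/-- the square root in E, F -/
lemma sqrt_split (q : ℝ) (hq0 : 0 < q) (n p : ℕ) :
    √((q ^ (-(n : ℝ) + p) - q ^ ((n : ℝ) - p)) * (q ^ (-(p : ℝ) - 1) - q ^ ((p : ℝ) + 1)))
      = q ^ ((-(n : ℝ) + 2 * p + 1) / 2) *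
        √((1 - q ^ (2 * (n : ℝ) - 2 * p)) * (q ^ (-2 * (p : ℝ) - 2) - 1)) := by
  have h1 : q ^ (-(n : ℝ) + p) - q ^ ((n : ℝ) - p)
      = q ^ (-(n : ℝ) + p) * (1 - q ^ (2 * (n : ℝ) - 2 * p)) := by
    rw [mul_sub, ← Real.rpow_add hq0]; ring_nf
  have h2 : q ^ (-(p : ℝ) - 1) - q ^ ((p : ℝ) + 1)
      = q ^ ((p : ℝ) + 1) * (q ^ (-2 * (p : ℝ) - 2) - 1) := by
    rw [mul_sub, ← Real.rpow_add hq0]; ring_nf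
  have h3 : q ^ (-(n : ℝ) + p) * q ^ ((p : ℝ) + 1) =
      (q ^ ((-(n : ℝ) + 2 * p + 1) / 2)) ^ 2 := by
    rw [← Real.rpow_add hq0, pow_two, ← Real.rpow_add hq0]; ring_nf
  rw [h1, h2, mul_mul_mul_comm, h3, Real.sqrt_mul (by positivity), Real.sqrt_sq (by positivity)]

lemma keyE (q : ℝ) (hq0 : 0 < q) (hq1 : q < 1) (n p : ℕ) (h : p < n) :
    q ^ (-(1 : ℝ) / 2) * ((q⁻¹ - q)⁻¹ *
      √((q ^ (-(n : ℝ) + p) - q ^ ((n : ℝ) - p)) * (q ^ (-(p : ℝ) - 1) - q ^ ((p : ℝ) + 1)))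
      * q ^ ((n : ℝ) / 2 - p)) * √(wt q n (p + 1)) =
    (q⁻¹ - q)⁻¹ * (1 - q ^ (2 * (n : ℝ) - 2 * p)) * √(wt q n p) := by
  have hr := (sq_ratio _ _ (wt q n p) (A_pos q hq0 hq1 n p h) (B_pos q hq0 hq1 p)).1
  have h3 : q ^ (-(1 : ℝ) / 2) * (q ^ ((-(n : ℝ) + 2 * p + 1) / 2) * q ^ ((n : ℝ) / 2 - p)) = 1 := by
    rw [← Real.rpow_add hq0, ← Real.rpow_add hq0, ← Real.rpow_zero q]; congr 1; ring
  rw [sqrt_split q hq0, wt_succ q hq0]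
  generalize √(wt q n p * _) = u at *
  generalize √(_ * _) = v at *
  linear_combination (q⁻¹ - q)⁻¹ * u * v * h3 + (q⁻¹ - q)⁻¹ * hr

lemma keyF (q : ℝ) (hq0 : 0 < q) (hq1 : q < 1) (n p : ℕ) (h : p < n) :
    q ^ (-(1 : ℝ) / 2) * ((q⁻¹ - q)⁻¹ *
      √((q ^ (-(n : ℝ) + p) - q ^ ((n : ℝ) - p)) * (q ^ (-(p : ℝ) - 1) - q ^ ((p : ℝ) + 1)))
      * q ^ (-(n : ℝ) / 2 + p)) * q ^ ((n : ℝ) - 2 * p) * √(wt q n p) =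
    (q⁻¹ - q)⁻¹ * (q ^ (-2 * (p : ℝ) - 2) - 1) * √(wt q n (p + 1)) := by
  have hr := (sq_ratio _ _ (wt q n p) (A_pos q hq0 hq1 n p h) (B_pos q hq0 hq1 p)).2
  have h3 : q ^ (-(1 : ℝ) / 2) * (q ^ ((-(n : ℝ) + 2 * p + 1) / 2) *
      (q ^ (-(n : ℝ) / 2 + p) * q ^ ((n : ℝ) - 2 * p))) = 1 := by
    rw [← Real.rpow_add hq0, ← Real.rpow_add hq0, ← Real.rpow_add hq0, ← Real.rpow_zero q]
    congr 1; ring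
  rw [sqrt_split q hq0, wt_succ q hq0]
  generalize √(wt q n p * _) = u at *
  generalize √(_ * _) = v at *
  generalize √(wt q n p) = w at *
  linear_combination (q⁻¹ - q)⁻¹ * w * v * h3 + (q⁻¹ - q)⁻¹ * hr

/-- The vector ξ⁺ = Σ_p (−i q^{−(a+n)})^p √((q^{2n}; q^{-2})_p / ((−1)^p (q^{-2}; q^{-2})_p)) ξ_p
is an eigenvector of i·π_{n/2}(B_t) with eigenvalue [a+n] = (q^{a+n} − q^{−a−n})/(q − q⁻¹),
where t = q^a − q^{-a} and B_t = q^{-1/2}(e − fk) − i(q−q⁻¹)⁻¹ t k. -/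
theorem stmt10 (q a : ℝ) (hq0 : 0 < q) (hq1 : q < 1) (n : ℕ)
    (E F K : Matrix (Fin (n + 1)) (Fin (n + 1)) ℂ)
    (hE : ∀ i j : Fin (n + 1), E i j =
      if (i : ℕ) + 1 = (j : ℕ) then
        (((q⁻¹ - q)⁻¹ *
          Real.sqrt ((q ^ (-(n : ℝ) + ((j : ℕ) : ℝ) - 1) - q ^ ((n : ℝ) - ((j : ℕ) : ℝ) + 1)) *
            (q ^ (-((j : ℕ) : ℝ)) - q ^ (((j : ℕ) : ℝ)))) *
          q ^ ((n : ℝ) / 2 - ((j : ℕ) : ℝ) + 1) : ℝ) : ℂ)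
      else 0)
    (hF : ∀ i j : Fin (n + 1), F i j =
      if (j : ℕ) + 1 = (i : ℕ) then
        (((q⁻¹ - q)⁻¹ *
          Real.sqrt ((q ^ (-(n : ℝ) + ((j : ℕ) : ℝ)) - q ^ ((n : ℝ) - ((j : ℕ) : ℝ))) *
            (q ^ (-((j : ℕ) : ℝ) - 1) - q ^ (((j : ℕ) : ℝ) + 1))) *
          q ^ (-(n : ℝ) / 2 + ((j : ℕ) : ℝ)) : ℝ) : ℂ)
      else 0)
    (hK : ∀ i j : Fin (n + 1), K i j =
      if i = j then ((q ^ ((n : ℝ) - 2 * ((i : ℕ) : ℝ)) : ℝ) : ℂ) else 0)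
    (t : ℝ) (ht : t = q ^ a - q ^ (-a))
    (iBt : Matrix (Fin (n + 1)) (Fin (n + 1)) ℂ)
    (hiBt : iBt = Complex.I • (((q ^ (-(1 : ℝ) / 2) : ℝ) : ℂ) • (E - F * K)
        - (Complex.I * ((q : ℂ) - (q : ℂ)⁻¹)⁻¹ * (t : ℂ)) • K))
    (ξ : Fin (n + 1) → ℂ)
    (hξ : ∀ p : Fin (n + 1), ξ p =
      (-Complex.I * ((q ^ (-(a + (n : ℝ))) : ℝ) : ℂ)) ^ (p : ℕ) *
        ((Real.sqrt (qPoch (q ^ (2 * n)) ((q ^ 2)⁻¹) (p : ℕ) /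
          ((-1 : ℝ) ^ (p : ℕ) * qPoch ((q ^ 2)⁻¹) ((q ^ 2)⁻¹) (p : ℕ))) : ℝ) : ℂ)) :
    iBt.mulVec ξ =
      (((q ^ (a + (n : ℝ)) - q ^ (-(a + (n : ℝ)))) / (q - q⁻¹) : ℝ) : ℂ) • ξ := by
  have hξ' : ∀ p : Fin (n + 1), ξ p = (-Complex.I * ((q ^ (-(a + (n : ℝ))) : ℝ) : ℂ)) ^ (p : ℕ) *
        ((√(wt q n p) : ℝ) : ℂ) := hξ
  clear hξ
  set x : ℝ := q ^ (-(a + (n : ℝ))) with hx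
  have hx0 : 0 < x := Real.rpow_pos_of_pos hq0 _
  set D : ℝ := (q⁻¹ - q)⁻¹ with hD
  have hEξ : ∀ i : Fin (n + 1), ((q ^ (-(1 : ℝ) / 2) : ℝ) : ℂ) * (E.mulVec ξ) i =
      ((D * (1 - q ^ (2 * (n : ℝ) - 2 * (i : ℕ))) : ℝ) : ℂ) * (-Complex.I * x) * ξ i := by
    intro i
    rw [Matrix.mulVec, dotProduct]
    by_cases hi : (i : ℕ) < n
    · have hj : (i : ℕ) + 1 < n + 1 := by omega
      rw [Finset.sum_eq_single (⟨i + 1, hj⟩ : Fin (n + 1))]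
      · rw [hE, hξ', hξ', if_pos rfl]
        have hk := keyE q hq0 hq1 n i hi
        rw [← hD] at hk
        have e1 : -(n : ℝ) + ((i + 1 : ℕ) : ℝ) - 1 = -(n : ℝ) + (i : ℕ) := by push_cast; ring
        have e2 : (n : ℝ) - ((i + 1 : ℕ) : ℝ) + 1 = (n : ℝ) - (i : ℕ) := by push_cast; ring
        have e3 : -((i + 1 : ℕ) : ℝ) = -((i : ℕ) : ℝ) - 1 := by push_cast; ring
        have e4 : (n : ℝ) / 2 - ((i + 1 : ℕ) : ℝ) + 1 = (n : ℝ) / 2 - (i : ℕ) := by push_cast; ring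
        have e5 : ((i + 1 : ℕ) : ℝ) = ((i : ℕ) : ℝ) + 1 := by push_cast; ring
        simp only [] 
        rw [e1, e2, e3, e4, e5]
        have hk' := congrArg (fun r : ℝ => (r : ℂ)) hk
        simp only [Complex.ofReal_mul] at hk' ⊢
        rw [pow_succ]
        linear_combination (-Complex.I * (x : ℂ)) ^ (i : ℕ) * (-Complex.I * (x : ℂ)) * hk'
      · intro b _ hb
        rw [hE, if_neg, zero_mul]
        intro h; apply hb; ext; simp [h]
      · simp
    · have hin : (i : ℕ) = n := by omega
      rw [Finset.sum_eq_zero]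
      · simp [hin]
      · intro b _
        rw [hE, if_neg (by omega), zero_mul]
  have hFξ : ∀ i : Fin (n + 1), (-Complex.I * x) * (((q ^ (-(1 : ℝ) / 2) : ℝ) : ℂ) *
      ((F * K).mulVec ξ) i) = ((D * (q ^ (-2 * ((i : ℕ) : ℝ)) - 1) : ℝ) : ℂ) * ξ i := by
    intro i
    have hKξ : ∀ j, K.mulVec ξ j = ((q ^ ((n : ℝ) - 2 * ((j : ℕ) : ℝ)) : ℝ) : ℂ) * ξ j := by
      intro j
      simp [Matrix.mulVec, dotProduct, hK]
    rw [← Matrix.mulVec_mulVec, Matrix.mulVec, dotProduct]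
    obtain ⟨i, hi⟩ := i
    rcases i with _ | p
    · rw [Finset.sum_eq_zero]
      · simp
      · intro b _
        rw [hF, if_neg (by simp), zero_mul]
    · have hp : p < n := by omega
      rw [Finset.sum_eq_single (⟨p, by omega⟩ : Fin (n + 1))]
      · rw [hKξ, hF, hξ', hξ', if_pos rfl]
        have hk := keyF q hq0 hq1 n p hp
        rw [← hD] at hk
        have e1 : -2 * ((p + 1 : ℕ) : ℝ) = -2 * (p : ℝ) - 2 := by push_cast; ring
        simp only []
        rw [e1]
        have hk' := congrArg (fun r : ℝ => (r : ℂ)) hk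
        simp only [Complex.ofReal_mul] at hk' ⊢
        rw [pow_succ]
        linear_combination (-Complex.I * (x : ℂ)) ^ p * (-Complex.I * (x : ℂ)) * hk'
      · intro b _ hb
        rw [hF, if_neg, zero_mul]
        intro h; apply hb; ext; simpa using h
      · simp
  ext i
  have hKi : K.mulVec ξ i = ((q ^ ((n : ℝ) - 2 * ((i : ℕ) : ℝ)) : ℝ) : ℂ) * ξ i := by
    simp [Matrix.mulVec, dotProduct, hK]
  have hE1 := hEξ i
  have hF1 := hFξ i
  have hDq : (q - q⁻¹)⁻¹ = -D := by rw [hD, ← inv_neg]; ring_nf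
  have hDc : ((q : ℂ) - (q : ℂ)⁻¹)⁻¹ = -(D : ℂ) := by
    rw [← Complex.ofReal_neg, ← hDq]; push_cast; rfl
  have hxi : q ^ (a + (n : ℝ)) = x⁻¹ := by rw [hx, ← Real.rpow_neg hq0.le]; ring_nf
  have hreal : x * (1 - q ^ (2 * (n : ℝ) - 2 * (i : ℕ))) + (q ^ (-2 * ((i : ℕ) : ℝ)) - 1) * x⁻¹
      - t * q ^ ((n : ℝ) - 2 * ((i : ℕ) : ℝ)) = x - x⁻¹ := by
    have h1 : x * q ^ (2 * (n : ℝ) - 2 * (i : ℕ)) = q ^ (-a) * q ^ ((n : ℝ) - 2 * ((i : ℕ) : ℝ)) := by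
      rw [hx, ← Real.rpow_add hq0, ← Real.rpow_add hq0]; ring_nf
    have h2 : q ^ (-2 * ((i : ℕ) : ℝ)) * x⁻¹ = q ^ a * q ^ ((n : ℝ) - 2 * ((i : ℕ) : ℝ)) := by
      rw [← hxi, ← Real.rpow_add hq0, ← Real.rpow_add hq0]; ring_nf
    rw [ht]; linear_combination h2 - h1
  have hF2 : ((q ^ (-(1 : ℝ) / 2) : ℝ) : ℂ) * ((F * K).mulVec ξ) i =
      Complex.I * (x : ℂ)⁻¹ * (((D * (q ^ (-2 * ((i : ℕ) : ℝ)) - 1) : ℝ) : ℂ) * ξ i) := by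
    rw [← hF1]
    have : (x : ℂ) ≠ 0 := by exact_mod_cast hx0.ne'
    field_simp
    rw [Complex.I_sq]; ring
  have hc := congrArg (fun r : ℝ => (r : ℂ)) hreal
  rw [hiBt, hxi, div_eq_mul_inv (x⁻¹ - x), hDq, hDc]
  simp only [Matrix.smul_mulVec, Matrix.sub_mulVec, Pi.smul_apply, Pi.sub_apply, smul_eq_mul,
    mul_sub, hKi] at hE1 hF2 ⊢
  rw [hE1, hF2]
  simp only [Complex.ofReal_mul, Complex.ofReal_sub, Complex.ofReal_add, Complex.ofReal_one,
    Complex.ofReal_neg, Complex.ofReal_inv] at hc ⊢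
  generalize ((q ^ ((n : ℝ) - 2 * ((i : ℕ) : ℝ)) : ℝ) : ℂ) = k at *
  generalize ((q ^ (2 * (n : ℝ) - 2 * ((i : ℕ) : ℝ)) : ℝ) : ℂ) = k2 at *
  generalize ((q ^ (-2 * ((i : ℕ) : ℝ)) : ℝ) : ℂ) = k3 at *
  have hI := Complex.I_sq
  linear_combination (D : ℂ) * ξ i * hc + (D : ℂ) * ξ i * (- (x:ℂ) * (1 - k2) - (x : ℂ)⁻¹ * (k3 - 1) + t * k) * hI
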